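/- The Jacobi triple product identity: for complex numbers q, z with |q| < 1 and z ≠ 0, the bilateral series ∑_{k∈ℤ} (−1)^k q^{k(k−1)/2} z^k converges absolutely and equals (q;q)_∞ (z;q)_∞ (q/z;q)_∞. -/

import Mathlib

/-- The infinite `q`-shifted factorial `(a;q)_∞`. -/
noncomputable def qPochInf (a q : ℂ) : ℂ := ∏' j : ℕ, (1 - a * q ^ j)

open Filter Topology

/-- The finite `q`-shifted factorial `(a;q)_n`. -/
noncomputable def qPoch (a q : ℂ) (n : ℕ) : ℂ := ∏ j ∈ Finset.range n, (1 - a * q ^ j)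

/-- The reciprocal of `(q;q)_m`, extended by zero to negative `m`. -/
noncomputable def qPochInv (q : ℂ) (m : ℤ) : ℂ := if m < 0 then 0 else (qPoch q q m.toNat)⁻¹

lemma qPoch_succ (a q : ℂ) (n : ℕ) : qPoch a q (n + 1) = qPoch a q n * (1 - a * q ^ n) :=
  Finset.prod_range_succ _ _

lemma summable_norm_mul_pow (a : ℂ) {q : ℂ} (hq : ‖q‖ < 1) :
    Summable fun j : ℕ => ‖-(a * q ^ j)‖ := by
  simpa [norm_mul, norm_pow] using
    (summable_geometric_of_lt_one (norm_nonneg q) hq).mul_left ‖a‖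

lemma tendsto_qPoch (a : ℂ) {q : ℂ} (hq : ‖q‖ < 1) :
    Tendsto (qPoch a q) atTop (𝓝 (qPochInf a q)) := by
  have h := (multipliable_one_add_of_summable (summable_norm_mul_pow a hq)).hasProd
  simp only [← sub_eq_add_neg] at h
  exact h.tendsto_prod_nat

lemma one_sub_mul_pow_ne_zero {q : ℂ} (hq : ‖q‖ < 1) (j : ℕ) : 1 - q * q ^ j ≠ 0 := by
  rw [← pow_succ', sub_ne_zero]
  intro h
  have h' := pow_lt_one₀ (norm_nonneg q) hq j.succ_ne_zero
  rw [← norm_pow, ← h, norm_one] at h'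
  exact lt_irrefl _ h'

lemma qPoch_self_ne_zero {q : ℂ} (hq : ‖q‖ < 1) (n : ℕ) : qPoch q q n ≠ 0 :=
  Finset.prod_ne_zero_iff.mpr fun j _ => one_sub_mul_pow_ne_zero hq j

lemma qPochInf_self_ne_zero {q : ℂ} (hq : ‖q‖ < 1) : qPochInf q q ≠ 0 := by
  have h := tprod_one_add_ne_zero_of_summable (f := fun j : ℕ => -(q * q ^ j))
    (fun j => by simpa only [← sub_eq_add_neg] using one_sub_mul_pow_ne_zero hq j)
    (summable_norm_mul_pow q hq)
  simp only [← sub_eq_add_neg] at h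
  exact h

lemma qPochInv_sub_one {q : ℂ} (hq : ‖q‖ < 1) (m : ℤ) :
    qPochInv q (m - 1) = (1 - q ^ m) * qPochInv q m := by
  rcases lt_trichotomy m 0 with h | rfl | h
  · simp [qPochInv, h, h.trans zero_lt_one]
  · simp [qPochInv]
  · obtain ⟨n, rfl⟩ : ∃ n : ℕ, m = n + 1 := ⟨(m - 1).toNat, by omega⟩
    have h1 : ¬ ((n : ℤ) + 1 < 0) := by omega
    have h2 := one_sub_mul_pow_ne_zero hq n
    have h3 := qPoch_self_ne_zero hq n
    have h4 : ((n : ℤ) + 1).toNat = n + 1 := by omega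
    have h5 : q ^ ((n : ℤ) + 1) = q * q ^ n := by rw [← pow_succ']; exact_mod_cast rfl
    simp only [qPochInv, add_sub_cancel_right, h1, h4, h5, qPoch_succ, Int.toNat_natCast,
      if_false, Int.natCast_nonneg, not_lt.mpr]
    field_simp

lemma tendsto_qPochInv {q : ℂ} (hq : ‖q‖ < 1) :
    Tendsto (qPochInv q) atTop (𝓝 (qPochInf q q)⁻¹) := by
  have h := ((tendsto_qPoch q hq).inv₀ (qPochInf_self_ne_zero hq)).comp
    (tendsto_atTop_atTop.mpr fun b => ⟨(b : ℤ), fun m hm => by omega⟩ :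
      Tendsto Int.toNat atTop atTop)
  refine h.congr' ?_
  filter_upwards [eventually_ge_atTop 0] with m hm
  simp [qPochInv, not_lt.mpr hm]

lemma exists_norm_qPochInv_le {q : ℂ} (hq : ‖q‖ < 1) : ∃ C, ∀ m, ‖qPochInv q m‖ ≤ C := by
  obtain ⟨C, hC⟩ := isBounded_iff_forall_norm_le.mp (Metric.isBounded_range_of_tendsto _
    ((tendsto_qPoch q hq).inv₀ (qPochInf_self_ne_zero hq)))
  refine ⟨C, fun m => ?_⟩
  have h := fun n : ℕ => hC _ (Set.mem_range_self n)
  unfold qPochInv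
  split_ifs
  · simpa using (norm_nonneg _).trans (h 0)
  · exact h _

lemma exists_norm_qPoch_le (a : ℂ) {q : ℂ} (hq : ‖q‖ < 1) : ∃ C, ∀ n, ‖qPoch a q n‖ ≤ C := by
  obtain ⟨C, hC⟩ := isBounded_iff_forall_norm_le.mp (Metric.isBounded_range_of_tendsto _
    (tendsto_qPoch a hq))
  exact ⟨C, fun n => hC _ (Set.mem_range_self n)⟩

lemma triangle_sub_one (k : ℤ) : (k - 1) * (k - 1 - 1) / 2 = k * (k - 1) / 2 - (k - 1) := by
  rw [show (k - 1) * (k - 1 - 1) = k * (k - 1) + (-(k - 1)) * 2 by ring,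
    Int.add_mul_ediv_right _ _ two_ne_zero]
  ring

lemma triangle_add_one (k : ℤ) : (k + 1) * (k + 1 - 1) / 2 = k * (k - 1) / 2 + k := by
  rw [show (k + 1) * (k + 1 - 1) = k * (k - 1) + k * 2 by ring,
    Int.add_mul_ediv_right _ _ two_ne_zero]

/-- The finite form of the Jacobi triple product identity. -/
lemma hasSum_finite_triple_product {q z : ℂ} (hq : ‖q‖ < 1) (hq0 : q ≠ 0) (hz : z ≠ 0) (n : ℕ) :
    HasSum (fun k : ℤ => (-1) ^ k * q ^ (k * (k - 1) / 2) * z ^ k *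
      (qPoch q q (2 * n) * qPochInv q (n + k) * qPochInv q (n - k)))
      (qPoch z q n * qPoch (q / z) q n) := by
  induction n with
  | zero =>
    convert hasSum_single (0 : ℤ) ?_ using 1
    · simp [qPoch, qPochInv]
    · intro k hk
      rcases lt_or_gt_of_ne hk with h | h <;> simp [qPochInv, h]
  | succ n ih =>
    have hp := (Equiv.addRight (1 : ℤ)).hasSum_iff.mpr ih
    have hm := (Equiv.subRight (1 : ℤ)).hasSum_iff.mpr ih
    have h := ((ih.mul_left (1 + q ^ (2 * n + 1))).sub (hm.mul_left (z * q ^ n))).sub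
      (hp.mul_left (q ^ (n + 1) / z))
    have hP : qPoch z q (n + 1) * qPoch (q / z) q (n + 1) =
        (1 + q ^ (2 * n + 1)) * (qPoch z q n * qPoch (q / z) q n) -
          z * q ^ n * (qPoch z q n * qPoch (q / z) q n) -
          q ^ (n + 1) / z * (qPoch z q n * qPoch (q / z) q n) := by
      rw [qPoch_succ, qPoch_succ]
      field_simp
      ring
    rw [hP]
    refine h.congr_fun fun k => ?_
    simp only [Function.comp_apply, Equiv.coe_addRight, Equiv.subRight_apply,
      triangle_sub_one, triangle_add_one]
    have e1 : qPochInv q (n + k) = (1 - q ^ (n + k + 1)) * qPochInv q (n + k + 1) := by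
      simpa using qPochInv_sub_one hq (n + k + 1)
    have e2 : qPochInv q (n - k) = (1 - q ^ (n - k + 1)) * qPochInv q (n - k + 1) := by
      simpa using qPochInv_sub_one hq (n - k + 1)
    have e3 := qPochInv_sub_one hq (n + k)
    have e4 := qPochInv_sub_one hq (n - k)
    rw [show ((n + 1 : ℕ) : ℤ) + k = n + k + 1 by push_cast; ring,
      show ((n + 1 : ℕ) : ℤ) - k = n - k + 1 by push_cast; ring,
      show (n : ℤ) + (k - 1) = n + k - 1 by ring, show (n : ℤ) - (k - 1) = n - k + 1 by ring,
      show (n : ℤ) + (k + 1) = n + k + 1 by ring, show (n : ℤ) - (k + 1) = n - k - 1 by ring,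
      e3, e4, e1, e2, show 2 * (n + 1) = 2 * n + 1 + 1 by ring, qPoch_succ, qPoch_succ]
    have hs : (-1 : ℂ) ≠ 0 := by norm_num
    simp only [zpow_add₀ hq0, zpow_sub₀ hq0, zpow_add₀ hz, zpow_sub₀ hz, zpow_add₀ hs,
      zpow_sub₀ hs, zpow_one, zpow_natCast, pow_add, pow_mul', pow_one]
    field_simp
    ring

lemma summable_triple_product {q z : ℂ} (hq : ‖q‖ < 1) (hq0 : q ≠ 0) (hz : z ≠ 0) :
    Summable fun k : ℤ => (-1) ^ k * q ^ (k * (k - 1) / 2) * z ^ k := by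
  set τ : ℂ := ((2 * Real.pi)⁻¹ : ℝ) * (-Complex.I * Complex.log q) with hτ
  set w : ℂ := (Complex.log (-z) - Complex.log q / 2) / (2 * Real.pi * Complex.I) with hw
  have him : 0 < τ.im := by
    rw [hτ, Complex.im_ofReal_mul]
    have : Real.log ‖q‖ < 0 := Real.log_neg (norm_pos_iff.mpr hq0) hq
    simp only [neg_mul, Complex.neg_im, Complex.I_mul_im, Complex.log_re]
    exact mul_pos (by positivity) (by linarith)
  refine ((summable_jacobiTheta₂_term_iff w τ).mpr him).congr fun k => ?_
  have h2 : k * (k - 1) / 2 * 2 = k * (k - 1) :=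
    Int.ediv_mul_cancel (by simpa using (Int.even_mul_pred_self k).two_dvd)
  have h3 : ((k * (k - 1) / 2 : ℤ) : ℂ) = k * (k - 1) / 2 := by
    rw [eq_div_iff two_ne_zero]; exact_mod_cast h2
  rw [mul_right_comm, ← mul_zpow, neg_one_mul, jacobiTheta₂_term]
  have hz' := Complex.exp_log (neg_ne_zero.mpr hz)
  have hq' := Complex.exp_log hq0
  generalize Complex.log (-z) = a at *
  generalize Complex.log q = b at *
  rw [← hz', ← hq', ← Complex.exp_int_mul, ← Complex.exp_int_mul, ← Complex.exp_add, h3]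
  congr 1
  simp only [hτ, hw]
  push_cast
  field_simp
  rw [Complex.I_sq]
  ring

lemma hasSum_triple_product_of_ne_zero {q z : ℂ} (hq : ‖q‖ < 1) (hq0 : q ≠ 0) (hz : z ≠ 0) :
    HasSum (fun k : ℤ => (-1) ^ k * q ^ (k * (k - 1) / 2) * z ^ k)
      (qPochInf q q * qPochInf z q * qPochInf (q / z) q) := by
  have hs := summable_triple_product hq hq0 hz
  obtain ⟨C, hC⟩ := exists_norm_qPoch_le q hq
  obtain ⟨D, hD⟩ := exists_norm_qPochInv_le hq
  have hC0 := (norm_nonneg _).trans (hC 0)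
  have hD0 := (norm_nonneg _).trans (hD 0)
  have hlim := tendsto_tsum_of_dominated_convergence (𝓕 := atTop)
    (f := fun (n : ℕ) (k : ℤ) => (-1) ^ k * q ^ (k * (k - 1) / 2) * z ^ k *
      (qPoch q q (2 * n) * qPochInv q (n + k) * qPochInv q (n - k)))
    (g := fun k : ℤ => (-1) ^ k * q ^ (k * (k - 1) / 2) * z ^ k *
      (qPochInf q q * (qPochInf q q)⁻¹ * (qPochInf q q)⁻¹))
    (hs.norm.mul_right (C * D * D))
    (fun k => by
      refine (((?_ : Tendsto _ _ _).mul ?_).mul ?_).const_mul _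
      · exact (tendsto_qPoch q hq).comp (tendsto_id.const_mul_atTop' two_pos)
      · exact (tendsto_qPochInv hq).comp
          (tendsto_atTop_add_const_right _ k tendsto_natCast_atTop_atTop)
      · exact (tendsto_qPochInv hq).comp
          (tendsto_atTop_add_const_right _ (-k) tendsto_natCast_atTop_atTop))
    (Eventually.of_forall fun n k => by
      rw [norm_mul, norm_mul (_ * qPochInv _ _), norm_mul (qPoch _ _ _)]
      gcongr <;> apply_assumption)
  simp only [(hasSum_finite_triple_product hq hq0 hz _).tsum_eq, tsum_mul_right,
    mul_inv_cancel₀ (qPochInf_self_ne_zero hq), one_mul] at hlim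
  have h := tendsto_nhds_unique hlim ((tendsto_qPoch z hq).mul (tendsto_qPoch (q / z) hq))
  rw [mul_inv_eq_iff_eq_mul₀ (qPochInf_self_ne_zero hq)] at h
  convert hs.hasSum using 1
  rw [h]
  ring

lemma qPochInf_zero_right (a : ℂ) : qPochInf a 0 = 1 - a := by
  rw [qPochInf, tprod_eq_mulSingle 0 fun j hj => by simp [hj]]
  simp

/-- The Jacobi triple product identity: for `‖q‖ < 1` and `z ≠ 0`,
`∑_{k∈ℤ} (−1)^k q^{k(k−1)/2} z^k = (q;q)_∞ (z;q)_∞ (q/z;q)_∞`.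
Here `q^{k(k−1)/2}` is `q` raised to the nonnegative integer `k(k−1)/2`. -/
theorem jacobi_triple_product (q z : ℂ) (hq : ‖q‖ < 1) (hz : z ≠ 0) :
    HasSum (fun k : ℤ => (-1 : ℂ) ^ k * q ^ (k * (k - 1) / 2).toNat * z ^ k)
      (qPochInf q q * qPochInf z q * qPochInf (q / z) q) := by
  have hT : ∀ k : ℤ, 0 ≤ k * (k - 1) / 2 := fun k =>
    Int.ediv_nonneg (by rcases le_or_gt k 0 with h | h <;> nlinarith) two_pos.le
  rcases eq_or_ne q 0 with rfl | hq0
  · simp only [qPochInf_zero_right, zero_div, sub_zero, one_mul, mul_one]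
    have h := hasSum_sum_of_ne_finset_zero (s := {0, 1}) (L := .unconditional ℤ)
      (f := fun k : ℤ => (-1 : ℂ) ^ k * 0 ^ (k * (k - 1) / 2).toNat * z ^ k) fun k hk => ?_
    · simpa [sub_eq_add_neg] using h
    · simp only [Finset.mem_insert, Finset.mem_singleton, not_or] at hk
      have h1 : 1 ≤ k * (k - 1) / 2 := by
        rw [Int.le_ediv_iff_mul_le two_pos]
        rcases lt_or_gt_of_ne hk.1 with h | h
        · nlinarith
        · have : 2 ≤ k := by omega
          nlinarith
      have h2 : (k * (k - 1) / 2).toNat ≠ 0 := by omega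
      simp [zero_pow h2]
  · convert hasSum_triple_product_of_ne_zero hq hq0 hz using 4 with k
    rw [← zpow_natCast q, Int.toNat_of_nonneg (hT k)]
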